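/- Suppose the dealer is a member of the Vamos pair C (e.g., the dealer is v6, so the access structure is V6 = Γ_{v6}). Then for any perfect secret sharing scheme, 16 ≤ 6·h(C|A) + 5·h(C|B) + h(B|C) + 2·h(D|C). -/

import Mathlib

open MeasureTheory Finset

/-- Shannon entropy of a random variable with values in a finite type:
`H(f) = ∑ₐ −P(f = a)·log P(f = a)`. -/
noncomputable def shannonEntropy {Ω : Type} [MeasurableSpace Ω] {α : Type} [Fintype α]
    (μ : Measure Ω) (f : Ω → α) : ℝ :=
  ∑ a : α, Real.negMulLog ((μ (f ⁻¹' {a})).toReal)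

/-- A family of random variables on a common probability space: one (finite-valued)
random variable `secret` for the secret, and one random variable `share p` for the
share of each participant `p`. -/
structure Scheme (P : Type) [Fintype P] [DecidableEq P] where
  (Ω : Type)
  [mΩ : MeasurableSpace Ω]
  (μ : Measure Ω)
  [prob : IsProbabilityMeasure μ]
  (SecT : Type)
  [secFin : Fintype SecT]
  (ShT : P → Type)
  [shFin : ∀ p, Fintype (ShT p)]
  (secret : Ω → SecT)
  (share : (p : P) → Ω → ShT p)
  (secret_meas : ∀ s : Set SecT, MeasurableSet (secret ⁻¹' s))
  (share_meas : ∀ p, ∀ s : Set (ShT p), MeasurableSet (share p ⁻¹' s))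

namespace Scheme

variable {P : Type} [Fintype P] [DecidableEq P]

/-- `H(S)`: the entropy of the secret. -/
noncomputable def Hsec (S : Scheme P) : ℝ :=
  letI := S.mΩ; letI := S.secFin
  shannonEntropy S.μ S.secret

/-- `H(X)`: the joint entropy of the shares of the participants in `X`. -/
noncomputable def Hset (S : Scheme P) (X : Finset P) : ℝ :=
  letI := S.mΩ; letI := S.shFin
  shannonEntropy S.μ (fun ω => fun p : {y // y ∈ X} => S.share p.1 ω)

/-- `H(X ∪ {S})`: the joint entropy of the shares of the participants in `X`
together with the secret. -/
noncomputable def HsetS (S : Scheme P) (X : Finset P) : ℝ :=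
  letI := S.mΩ; letI := S.secFin; letI := S.shFin
  shannonEntropy S.μ (fun ω => ((fun p : {y // y ∈ X} => S.share p.1 ω), S.secret ω))

/-- The normalized entropy `h(X) = H(X)/H(S)`. -/
noncomputable def hset (S : Scheme P) (X : Finset P) : ℝ := S.Hset X / S.Hsec

/-- The conditional normalized entropy `h(X|Y) = h(X ∪ Y) − h(Y)`. -/
noncomputable def hcond (S : Scheme P) (X Y : Finset P) : ℝ :=
  S.hset (X ∪ Y) - S.hset Y

/-- `Σ` is a perfect secret sharing scheme for the access structure `Γ`:
the conditional entropy `H(S|X) = H(X ∪ {S}) − H(X)` equals `0` for every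
qualified set `X` and equals `H(S)` for every unqualified set `X`. -/
def IsPerfect (S : Scheme P) (Γ : Finset P → Prop) : Prop :=
  (∀ X : Finset P, Γ X → S.HsetS X - S.Hset X = 0) ∧
  (∀ X : Finset P, ¬ Γ X → S.HsetS X - S.Hset X = S.Hsec)

end Scheme
/-- The four Vamos pairs `A = {v₁,v₂}`, `B = {v₃,v₄}`, `C = {v₅,v₆}`, `D = {v₇,v₈}`,
where participant `vᵢ` is represented by `(i-1 : Fin 8)`. -/
def pairA : Finset (Fin 8) := {0, 1}
def pairB : Finset (Fin 8) := {2, 3}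
def pairC : Finset (Fin 8) := {4, 5}
def pairD : Finset (Fin 8) := {6, 7}

/-- `X` is one of the four Vamos pairs. -/
def IsVamosPair (X : Finset (Fin 8)) : Prop :=
  X = pairA ∨ X = pairB ∨ X = pairC ∨ X = pairD

/-- The dependent sets of the Vamos matroid: the five special four-element sets
`AB`, `AC`, `BC`, `BD`, `CD`, and all sets with at least five elements. -/
def VamosDep (X : Finset (Fin 8)) : Prop :=
  X = pairA ∪ pairB ∨ X = pairA ∪ pairC ∨ X = pairB ∪ pairC ∨
    X = pairB ∪ pairD ∨ X = pairC ∪ pairD ∨ 5 ≤ X.card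

/-- The circuits of the Vamos matroid: minimal dependent sets. -/
def VamosCircuit (X : Finset (Fin 8)) : Prop :=
  VamosDep X ∧ ∀ Y ⊂ X, ¬ VamosDep Y

/-- The access structure `Γₓ` induced by the Vamos matroid with dealer `x`
(the dealer is regarded as a participant who is individually qualified):
a set is qualified iff it contains a minimal qualified set, the minimal
qualified sets being `{x}` and the sets `M ⊆ Q \ {x}` with `M ∪ {x}` a circuit. -/
def VamosQualified (x : Fin 8) (Y : Finset (Fin 8)) : Prop :=
  x ∈ Y ∨ ∃ M ⊆ Y, x ∉ M ∧ VamosCircuit (insert x M)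

/-- `λ = (max₁≤ᵢ≤₈ h({vᵢ})) − 1`. -/
noncomputable def Scheme.lam (S : Scheme (Fin 8)) : ℝ :=
  (Finset.univ.sup' Finset.univ_nonempty fun i : Fin 8 => S.hset {i}) - 1

/-- The information rate `ρ(Σ) = min₁≤ᵢ≤₈ H(S)/H(vᵢ)` of a scheme. -/
noncomputable def Scheme.rho (S : Scheme (Fin 8)) : ℝ :=
  Finset.univ.inf' Finset.univ_nonempty fun i : Fin 8 => S.Hsec / S.Hset {i}

section WeightedEntropy

variable {Ω : Type*} [Fintype Ω]

open Classical in
/-- The total weight of the `r`-class of `a`. -/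
noncomputable def classMass (w : Ω → ℝ) (r : Setoid Ω) (a : Ω) : ℝ :=
  ∑ b with r b a, w b

/-- The entropy of the partition into `r`-classes of a finite space with weights `w`. -/
noncomputable def partitionEntropy (w : Ω → ℝ) (r : Setoid Ω) : ℝ :=
  -∑ a, w a * Real.log (classMass w r a)

variable {w : Ω → ℝ}

lemma classMass_pos (hw : 0 ≤ w) (r : Setoid Ω) {a : Ω} (ha : w a ≠ 0) :
    0 < classMass w r a := by
  classical
  refine Finset.sum_pos' (fun b _ => hw b) ⟨a, ?_, lt_of_le_of_ne (hw a) ha.symm⟩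
  simp

lemma classMass_nonneg (hw : 0 ≤ w) (r : Setoid Ω) (a : Ω) : 0 ≤ classMass w r a :=
  Finset.sum_nonneg fun b _ => hw b

lemma classMass_congr {r : Setoid Ω} {a b : Ω} (h : r a b) :
    classMass w r a = classMass w r b := by
  classical
  unfold classMass
  congr 1
  ext c
  simp only [Finset.mem_filter, Finset.mem_univ, true_and]
  exact ⟨fun hc => r.trans hc h, fun hc => r.trans hc (r.symm h)⟩

/-- Refining a partition does not decrease its entropy. -/
lemma partitionEntropy_anti (hw : 0 ≤ w) {r s : Setoid Ω} (h : r ≤ s) :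
    partitionEntropy w s ≤ partitionEntropy w r := by
  classical
  refine neg_le_neg (Finset.sum_le_sum fun a _ => ?_)
  by_cases ha : w a = 0
  · simp [ha]
  refine mul_le_mul_of_nonneg_left (Real.log_le_log (classMass_pos hw r ha) ?_) (hw a)
  refine Finset.sum_le_sum_of_subset_of_nonneg ?_ fun b _ _ => hw b
  intro b hb
  simp only [Finset.mem_filter, Finset.mem_univ, true_and] at hb ⊢
  exact h hb

/-- Entropy only depends on the partition of the support. -/
lemma partitionEntropy_congr {r s : Setoid Ω}
    (h : ∀ a b, w a ≠ 0 → w b ≠ 0 → (r a b ↔ s a b)) :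
    partitionEntropy w r = partitionEntropy w s := by
  classical
  unfold partitionEntropy
  congr 1
  refine Finset.sum_congr rfl fun a _ => ?_
  by_cases ha : w a = 0
  · simp [ha]
  congr 2
  simp only [classMass, Finset.sum_filter]
  refine Finset.sum_congr rfl fun b _ => ?_
  by_cases hb : w b = 0
  · simp [hb]
  · simp [h b a hb ha]

open Classical in
lemma sum_mul_classMass_div_le (hw : 0 ≤ w) (r s : Setoid Ω) :
    ∑ a, w a * (classMass w r a * classMass w s a /
      (classMass w (r ⊓ s) a * classMass w (r ⊔ s) a)) ≤ ∑ a, w a := by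
  have hinner : ∀ b c, ∑ a, (if r b a ∧ s c a then w a / classMass w (r ⊓ s) a else 0) ≤
      if (r ⊔ s) c b then 1 else 0 := by
    intro b c
    by_cases hex : ∃ a, r b a ∧ s c a
    · obtain ⟨a₀, hb, hc⟩ := hex
      have hbc : (r ⊔ s) c b := (r ⊔ s).trans (le_sup_right (a := r) hc)
        ((r ⊔ s).symm (le_sup_left (b := s) hb))
      have key : ∀ a, (if r b a ∧ s c a then w a / classMass w (r ⊓ s) a else 0) =
          (if (r ⊓ s) a a₀ then w a else 0) / classMass w (r ⊓ s) a₀ := by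
        intro a
        by_cases h : (r ⊓ s) a a₀
        · have h' : r b a ∧ s c a := ⟨r.trans hb (r.symm h.1), s.trans hc (s.symm h.2)⟩
          rw [if_pos h, if_pos h', classMass_congr h]
        · have h' : ¬ (r b a ∧ s c a) := fun h' =>
            h ⟨r.trans (r.symm h'.1) hb, s.trans (s.symm h'.2) hc⟩
          rw [if_neg h, if_neg h', zero_div]
      rw [Finset.sum_congr rfl fun a _ => key a, ← Finset.sum_div, ← Finset.sum_filter,
        if_pos hbc]
      exact div_self_le_one _
    · rw [Finset.sum_eq_zero fun a _ => if_neg fun h => hex ⟨a, h⟩]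
      split_ifs <;> norm_num
  have expand : ∀ a, w a * (classMass w r a * classMass w s a /
      (classMass w (r ⊓ s) a * classMass w (r ⊔ s) a)) =
      ∑ b, ∑ c, w b * (w c / classMass w (r ⊔ s) b *
        (if r b a ∧ s c a then w a / classMass w (r ⊓ s) a else 0)) := by
    intro a
    have : ∀ b, ∑ c, w b * (w c / classMass w (r ⊔ s) b *
        (if r b a ∧ s c a then w a / classMass w (r ⊓ s) a else 0)) =
        (if r b a then w b else 0) * (classMass w s a *
          (w a / (classMass w (r ⊓ s) a * classMass w (r ⊔ s) a))) := by
      intro b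
      by_cases hb : r b a
      · rw [if_pos hb, classMass_congr (le_sup_left (b := s) hb : (r ⊔ s) b a)]
        simp only [classMass.eq_1 w s, hb, true_and, Finset.sum_filter, Finset.sum_mul,
          Finset.mul_sum]
        refine Finset.sum_congr rfl fun c _ => ?_
        split_ifs <;> ring
      · simp [hb]
    rw [Finset.sum_congr rfl fun b _ => this b, ← Finset.sum_mul, ← Finset.sum_filter]
    change _ = classMass w r a * _
    ring
  calc _ = ∑ b, ∑ c, w b * (w c / classMass w (r ⊔ s) b *
        ∑ a, (if r b a ∧ s c a then w a / classMass w (r ⊓ s) a else 0)) := by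
        rw [Finset.sum_congr rfl fun a _ => expand a, Finset.sum_comm]
        refine Finset.sum_congr rfl fun b _ => ?_
        rw [Finset.sum_comm]
        simp only [Finset.mul_sum]
    _ ≤ ∑ b, ∑ c, w b * (w c / classMass w (r ⊔ s) b * if (r ⊔ s) c b then 1 else 0) := by
        gcongr with b _ c _
        · exact hw b
        · exact div_nonneg (hw c) (classMass_nonneg hw _ b)
        · exact hinner b c
    _ = ∑ b, w b * (classMass w (r ⊔ s) b / classMass w (r ⊔ s) b) := by
        refine Finset.sum_congr rfl fun b _ => ?_
        rw [← Finset.mul_sum]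
        congr 1
        conv_rhs => rw [classMass, Finset.sum_div, Finset.sum_filter]
        refine Finset.sum_congr rfl fun c _ => ?_
        simp only [mul_ite, mul_one, mul_zero]
        rfl
    _ ≤ ∑ b, w b := by
        gcongr with b _
        exact mul_le_of_le_one_right (hw b) (div_self_le_one _)

/-- Submodularity of entropy on the lattice of partitions. -/
lemma partitionEntropy_submodular (hw : 0 ≤ w) (r s : Setoid Ω) :
    partitionEntropy w (r ⊓ s) + partitionEntropy w (r ⊔ s) ≤
      partitionEntropy w r + partitionEntropy w s := by
  have hlog : ∑ a, w a * (Real.log (classMass w r a) + Real.log (classMass w s a)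
      - Real.log (classMass w (r ⊓ s) a) - Real.log (classMass w (r ⊔ s) a)) ≤
      ∑ a, (w a * (classMass w r a * classMass w s a /
      (classMass w (r ⊓ s) a * classMass w (r ⊔ s) a)) - w a) := by
    refine Finset.sum_le_sum fun a _ => ?_
    by_cases ha : w a = 0
    · simp [ha]
    have h1 := classMass_pos hw r ha
    have h2 := classMass_pos hw s ha
    have h3 := classMass_pos hw (r ⊓ s) ha
    have h4 := classMass_pos hw (r ⊔ s) ha
    have h := Real.log_le_sub_one_of_pos (div_pos (mul_pos h1 h2) (mul_pos h3 h4))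
    rw [Real.log_div (mul_pos h1 h2).ne' (mul_pos h3 h4).ne', Real.log_mul h1.ne' h2.ne',
      Real.log_mul h3.ne' h4.ne'] at h
    nlinarith [mul_le_mul_of_nonneg_left h (hw a)]
  have hle := sum_mul_classMass_div_le hw r s
  simp only [Finset.sum_sub_distrib, Finset.sum_add_distrib, mul_add, mul_sub] at hlog
  unfold partitionEntropy
  linarith

end WeightedEntropy

section JointEntropy

variable {Ω ι : Type*} [Fintype Ω] {w : Ω → ℝ}

/-- The joint entropy of the subfamily of `X` indexed by `I`, where a random variable is
represented by the partition of the weighted space `Ω` into its level sets. -/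
noncomputable def jointEntropy (w : Ω → ℝ) (X : ι → Setoid Ω) (I : Finset ι) : ℝ :=
  partitionEntropy w (I.inf X)

lemma finset_inf_rel {Ω ι : Type*} (X : ι → Setoid Ω) (I : Finset ι) (a b : Ω) :
    (I.inf X) a b ↔ ∀ i ∈ I, X i a b := by
  classical
  induction I using Finset.induction_on with
  | empty => exact iff_of_true trivial (by simp)
  | insert i I _ ih =>
    rw [Finset.inf_insert, Finset.forall_mem_insert, ← ih]
    rfl

lemma jointEntropy_mono (hw : 0 ≤ w) (X : ι → Setoid Ω) {I J : Finset ι} (h : I ⊆ J) :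
    jointEntropy w X I ≤ jointEntropy w X J :=
  partitionEntropy_anti hw (Finset.inf_mono h)

variable [DecidableEq ι]

lemma jointEntropy_submodular (hw : 0 ≤ w) (X : ι → Setoid Ω) (I J : Finset ι) :
    jointEntropy w X (I ∪ J) + jointEntropy w X (I ∩ J) ≤
      jointEntropy w X I + jointEntropy w X J := by
  have h := partitionEntropy_submodular hw (I.inf X) (J.inf X)
  have h' : partitionEntropy w ((I ∩ J).inf X) ≤ partitionEntropy w (I.inf X ⊔ J.inf X) :=
    partitionEntropy_anti hw
      (sup_le (Finset.inf_mono Finset.inter_subset_left) (Finset.inf_mono Finset.inter_subset_right))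
  unfold jointEntropy
  rw [Finset.inf_union]
  linarith

open Classical in
/-- The weights of two copies of a weighted space coupled so that they agree on the `z`-class
and are conditionally independent given it. -/
noncomputable def coupling (w : Ω → ℝ) (z : Setoid Ω) (p : Ω × Ω) : ℝ :=
  if z p.1 p.2 then w p.1 * w p.2 / classMass w z p.1 else 0

lemma coupling_nonneg (hw : 0 ≤ w) (z : Setoid Ω) : 0 ≤ coupling w z := by
  intro p
  simp only [coupling, Pi.zero_apply]
  split_ifs
  · exact div_nonneg (mul_nonneg (hw _) (hw _)) (classMass_nonneg hw z _)
  · exact le_rfl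

lemma coupling_ne_zero {z : Setoid Ω} {p : Ω × Ω} (h : coupling w z p ≠ 0) :
    z p.1 p.2 ∧ w p.1 ≠ 0 ∧ w p.2 ≠ 0 := by
  unfold coupling at h
  split_ifs at h with hz
  · refine ⟨hz, ?_, ?_⟩ <;> intro h0 <;> simp [h0] at h
  · exact absurd rfl h

lemma sum_coupling_fst (hw : 0 ≤ w) (z : Setoid Ω) (F : Ω → ℝ) :
    ∑ p, coupling w z p * F p.1 = ∑ a, w a * F a := by
  classical
  rw [Fintype.sum_prod_type]
  refine Finset.sum_congr rfl fun a _ => ?_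
  by_cases ha : w a = 0
  · simp [coupling, ha]
  have hpos := classMass_pos hw z ha
  have : ∀ b, coupling w z (a, b) * F a =
      (if z b a then w b else 0) * (w a * F a / classMass w z a) := by
    intro b
    by_cases h : z a b
    · rw [coupling, if_pos h, if_pos (z.symm h)]
      ring
    · rw [coupling, if_neg h, if_neg fun h' => h (z.symm h')]
      ring
  rw [Finset.sum_congr rfl fun b _ => this b, ← Finset.sum_mul, ← Finset.sum_filter]
  change classMass w z a * _ = _
  field_simp

lemma coupling_swap (z : Setoid Ω) (p : Ω × Ω) : coupling w z p.swap = coupling w z p := by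
  unfold coupling
  by_cases h : z p.1 p.2
  · rw [if_pos h, if_pos (show z p.swap.1 p.swap.2 from z.symm h), classMass_congr h, mul_comm]
    rfl
  · rw [if_neg h, if_neg fun h' : z p.swap.1 p.swap.2 => h (z.symm h')]

lemma sum_coupling_snd (hw : 0 ≤ w) (z : Setoid Ω) (F : Ω → ℝ) :
    ∑ p, coupling w z p * F p.2 = ∑ a, w a * F a := by
  rw [← sum_coupling_fst hw z F, ← (Equiv.prodComm Ω Ω).sum_comp]
  exact Finset.sum_congr rfl fun p _ => by
    rw [Equiv.prodComm_apply, coupling_swap, Prod.snd_swap]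

lemma partitionEntropy_coupling_fst (hw : 0 ≤ w) (z r : Setoid Ω) :
    partitionEntropy (coupling w z) (r.comap Prod.fst) = partitionEntropy w r := by
  classical
  have hmass : ∀ p, classMass (coupling w z) (r.comap Prod.fst) p = classMass w r p.1 := by
    intro p
    have := sum_coupling_fst hw z fun a => if r a p.1 then 1 else 0
    simpa [classMass, Finset.sum_filter, Setoid.comap_rel] using this
  simp only [partitionEntropy, hmass]
  rw [sum_coupling_fst hw z fun a => Real.log (classMass w r a)]

lemma partitionEntropy_coupling_snd (hw : 0 ≤ w) (z r : Setoid Ω) :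
    partitionEntropy (coupling w z) (r.comap Prod.snd) = partitionEntropy w r := by
  classical
  have hmass : ∀ p, classMass (coupling w z) (r.comap Prod.snd) p = classMass w r p.2 := by
    intro p
    have := sum_coupling_snd hw z fun a => if r a p.2 then 1 else 0
    simpa [classMass, Finset.sum_filter, Setoid.comap_rel] using this
  simp only [partitionEntropy, hmass]
  rw [sum_coupling_snd hw z fun a => Real.log (classMass w r a)]

/-- Conditional independence of the two factors of a coupling. -/
lemma partitionEntropy_coupling_inf (hw : 0 ≤ w) {z r : Setoid Ω} (hr : r ≤ z) (x : Setoid Ω) :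
    partitionEntropy (coupling w z) (x.comap Prod.snd ⊓ r.comap Prod.fst) +
      partitionEntropy w z = partitionEntropy w (x ⊓ z) + partitionEntropy w r := by
  classical
  have hmass : ∀ p, coupling w z p ≠ 0 →
      classMass (coupling w z) (x.comap Prod.snd ⊓ r.comap Prod.fst) p =
        classMass w r p.1 * classMass w (x ⊓ z) p.2 / classMass w z p.1 := by
    rintro ⟨a, b⟩ hp
    have hab : z a b := (coupling_ne_zero hp).1
    simp only [classMass.eq_1 _ (_ ⊓ _), classMass.eq_1 w r, Finset.sum_filter,
      Fintype.sum_prod_type, Finset.sum_mul_sum, Finset.sum_div]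
    refine Finset.sum_congr rfl fun c _ => Finset.sum_congr rfl fun d _ => ?_
    by_cases hc : r c a
    · have hca : z c a := hr hc
      have hiff : z c d ↔ z d b :=
        ⟨fun h => z.trans (z.symm h) (z.trans hca hab),
          fun h => z.trans hca (z.trans hab (z.symm h))⟩
      have hmem : (x.comap Prod.snd ⊓ r.comap Prod.fst) (c, d) (a, b) ↔ x d b :=
        ⟨fun h => h.1, fun h => ⟨h, hc⟩⟩
      have hmem' : (x ⊓ z) d b ↔ x d b ∧ z d b := Iff.rfl
      rw [if_pos hc]
      simp only [hmem, hmem', coupling, hiff, classMass_congr hca]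
      by_cases h1 : x d b <;> by_cases h2 : z d b <;> simp [h1, h2]
    · have hmem : ¬ (x.comap Prod.snd ⊓ r.comap Prod.fst) (c, d) (a, b) := fun h => hc h.2
      simp [hc, hmem]
  have hlog : ∀ p, coupling w z p *
      Real.log (classMass (coupling w z) (x.comap Prod.snd ⊓ r.comap Prod.fst) p) =
      coupling w z p * Real.log (classMass w r p.1) +
        coupling w z p * Real.log (classMass w (x ⊓ z) p.2) -
        coupling w z p * Real.log (classMass w z p.1) := by
    intro p
    by_cases hp : coupling w z p = 0
    · simp [hp]
    obtain ⟨-, h1, h2⟩ := coupling_ne_zero hp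
    have hr1 := classMass_pos hw r h1
    have hx2 := classMass_pos hw (x ⊓ z) h2
    rw [hmass p hp, Real.log_div (mul_pos hr1 hx2).ne' (classMass_pos hw z h1).ne',
      Real.log_mul hr1.ne' hx2.ne']
    ring
  simp only [partitionEntropy, hlog, Finset.sum_add_distrib, Finset.sum_sub_distrib]
  rw [sum_coupling_fst hw z fun a => Real.log (classMass w r a),
    sum_coupling_fst hw z fun a => Real.log (classMass w z a),
    sum_coupling_snd hw z fun a => Real.log (classMass w (x ⊓ z) a)]
  ring

/-- The copy lemma: the variable `n` can be replaced by a copy of `j` over `Z` that is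
conditionally independent of `R` given `Z`. -/
lemma exists_copy (hw : 0 ≤ w) (X : ι → Setoid Ω) {j n : ι} {Z R : Finset ι}
    (hZR : Z ⊆ R) (hn : n ∉ R) :
    ∃ (w' : Ω × Ω → ℝ) (X' : ι → Setoid (Ω × Ω)), 0 ≤ w' ∧
      (∀ I, n ∉ I → jointEntropy w' X' I = jointEntropy w X I) ∧
      (∀ I ⊆ Z, jointEntropy w' X' (insert n I) = jointEntropy w X (insert j I)) ∧
      jointEntropy w' X' (insert n R) + jointEntropy w X Z =
        jointEntropy w X (insert j Z) + jointEntropy w X R := by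
  set z := Z.inf X
  set X' : ι → Setoid (Ω × Ω) :=
    Function.update (fun i => (X i).comap Prod.fst) n ((X j).comap Prod.snd) with hX'
  have hinf : ∀ I : Finset ι, n ∉ I → I.inf X' = (I.inf X).comap Prod.fst := by
    intro I hI
    ext a b
    rw [finset_inf_rel, Setoid.comap_rel, finset_inf_rel]
    refine forall₂_congr fun i hi => ?_
    rw [hX', Function.update_of_ne (ne_of_mem_of_not_mem hi hI), Setoid.comap_rel]
  have hins : ∀ I : Finset ι, n ∉ I →
      (insert n I).inf X' = (X j).comap Prod.snd ⊓ (I.inf X).comap Prod.fst := by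
    intro I hI
    rw [Finset.inf_insert, hinf I hI, hX', Function.update_self]
  refine ⟨coupling w z, X', coupling_nonneg hw z, fun (I : Finset ι) hI => ?_,
    fun (I : Finset ι) hI => ?_, ?_⟩
  · rw [jointEntropy, hinf I hI, partitionEntropy_coupling_fst hw, jointEntropy]
  · rw [jointEntropy, hins I fun h => hn (hZR (hI h)), jointEntropy, Finset.inf_insert,
      ← partitionEntropy_coupling_snd hw z]
    refine partitionEntropy_congr fun p q hp hq => ?_
    have hle : z ≤ I.inf X := Finset.inf_mono hI
    have hp' := hle (coupling_ne_zero hp).1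
    have hq' := hle (coupling_ne_zero hq).1
    refine and_congr_right fun _ => ⟨fun h => ?_, fun h => ?_⟩
    · exact (I.inf X).trans ((I.inf X).symm hp') ((I.inf X).trans h hq')
    · exact (I.inf X).trans hp' ((I.inf X).trans h ((I.inf X).symm hq'))
  · have h := partitionEntropy_coupling_inf hw (Finset.inf_mono hZR : R.inf X ≤ z) (X j)
    rw [← hins R hn, ← Finset.inf_insert] at h
    exact h

end JointEntropy

section FourVariables

variable {Ω : Type*} [Fintype Ω] {w : Ω → ℝ}

/-- A non-Shannon inequality for `X 0, …, X 3`, obtained by copying `X 0` over `X 1, X 2` and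
then copying that copy over `X 0, X 2`. -/
lemma jointEntropy_fin_six_le (hw : 0 ≤ w) (X : Fin 6 → Setoid Ω) :
    9 * jointEntropy w X {0, 1, 2} + 3 * jointEntropy w X {0} + 5 * jointEntropy w X {1} +
        3 * jointEntropy w X {2} + 2 * jointEntropy w X {0, 3} +
        2 * jointEntropy w X {1, 2, 3} ≤
      8 * jointEntropy w X {0, 1} + 6 * jointEntropy w X {0, 2} + 6 * jointEntropy w X {1, 2} +
        2 * jointEntropy w X {1, 3} + 2 * jointEntropy w X {2, 3} := by
  obtain ⟨w₁, X₁, hw₁, old₁, copy₁, indep₁⟩ := exists_copy hw X (j := 0) (n := 4) (Z := {1, 2})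
    (R := {0, 1, 2, 3}) (by decide) (by decide)
  obtain ⟨w₂, X₂, hw₂, old₂, copy₂, indep₂⟩ := exists_copy hw₁ X₁ (j := 4) (n := 5) (Z := {0, 2})
    (R := {0, 1, 2, 3, 4}) (by decide) (by decide)
  have old : ∀ I : Finset (Fin 6), 4 ∉ I ∧ 5 ∉ I →
      jointEntropy w X I = jointEntropy w₂ X₂ I := fun I hI => by
    rw [old₂ I hI.2, old₁ I hI.1]
  have fst : ∀ I : Finset (Fin 6), I ⊆ {1, 2} → ∀ J K, insert 4 I = J → insert 0 I = K →
      jointEntropy w₂ X₂ J = jointEntropy w₂ X₂ K := by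
    rintro I hI _ _ rfl rfl
    have h : ∀ I ⊆ ({1, 2} : Finset (Fin 6)), 5 ∉ insert 4 I ∧ 4 ∉ insert 0 I ∧ 5 ∉ insert 0 I := by
      decide
    rw [old₂ _ (h I hI).1, copy₁ I hI, old _ (h I hI).2]
  have snd : ∀ I : Finset (Fin 6), I ⊆ {0, 2} → ∀ J K, insert 5 I = J → insert 4 I = K →
      jointEntropy w₂ X₂ J = jointEntropy w₂ X₂ K := by
    rintro I hI _ _ rfl rfl
    have h : ∀ I ⊆ ({0, 2} : Finset (Fin 6)), 5 ∉ insert 4 I := by decide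
    rw [copy₂ I hI, old₂ _ (h I hI)]
  have sub : ∀ I J U K : Finset (Fin 6), I ∪ J = U → I ∩ J = K →
      jointEntropy w₂ X₂ U + jointEntropy w₂ X₂ K ≤
        jointEntropy w₂ X₂ I + jointEntropy w₂ X₂ J := by
    rintro I J _ _ rfl rfl
    exact jointEntropy_submodular hw₂ X₂ I J
  have e₁ := fst ∅ (by decide) {4} {0} (by decide) (by decide)
  have e₂ := fst {1} (by decide) {1, 4} {0, 1} (by decide) (by decide)
  have e₃ := fst {2} (by decide) {2, 4} {0, 2} (by decide) (by decide)
  have e₄ := fst {1, 2} (by decide) {1, 2, 4} {0, 1, 2} (by decide) (by decide)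
  have f₁ := snd ∅ (by decide) {5} {4} (by decide) (by decide)
  have f₂ := snd {0} (by decide) {0, 5} {0, 4} (by decide) (by decide)
  have f₃ := snd {2} (by decide) {2, 5} {2, 4} (by decide) (by decide)
  have f₄ := snd {0, 2} (by decide) {0, 2, 5} {0, 2, 4} (by decide) (by decide)
  rw [show (insert 4 {0, 1, 2, 3} : Finset (Fin 6)) = {0, 1, 2, 3, 4} by decide,
    ← old₂ _ (by decide), old _ (by decide), old _ (by decide), old _ (by decide)] at indep₁
  rw [show (insert 5 {0, 1, 2, 3, 4} : Finset (Fin 6)) = {0, 1, 2, 3, 4, 5} by decide,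
    show (insert 4 {0, 2} : Finset (Fin 6)) = {0, 2, 4} by decide,
    ← old₂ _ (by decide), ← old₂ _ (by decide), ← old₂ _ (by decide)] at indep₂
  have s1 := sub {2, 3} {2, 5} {2, 3, 5} {2} (by decide) (by decide)
  have s2 := sub {0, 1, 2, 3} {0, 1, 2, 5} {0, 1, 2, 3, 5} {0, 1, 2} (by decide) (by decide)
  have s3 := sub {0, 1, 2, 3} {0, 2, 3, 4} {0, 1, 2, 3, 4} {0, 2, 3} (by decide) (by decide)
  have s4 := sub {0, 2, 3} {0, 3, 5} {0, 2, 3, 5} {0, 3} (by decide) (by decide)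
  have s5 := sub {0, 2, 3} {0, 2, 5} {0, 2, 3, 5} {0, 2} (by decide) (by decide)
  have s6 := sub {1, 3, 4} {2, 3, 4} {1, 2, 3, 4} {3, 4} (by decide) (by decide)
  have s7 := sub {0, 1} {0, 5} {0, 1, 5} {0} (by decide) (by decide)
  have s8 := sub {1, 3} {1, 4} {1, 3, 4} {1} (by decide) (by decide)
  have s9 := sub {1, 2, 4} {2, 4, 5} {1, 2, 4, 5} {2, 4} (by decide) (by decide)
  have s10 := sub {0, 2, 3} {0, 3, 4} {0, 2, 3, 4} {0, 3} (by decide) (by decide)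
  have s11 := sub {0, 5} {3, 5} {0, 3, 5} {5} (by decide) (by decide)
  have s12 := sub {0, 1, 5} {1, 2, 5} {0, 1, 2, 5} {1, 5} (by decide) (by decide)
  have s13 := sub {1, 2, 3, 5} {1, 2, 4, 5} {1, 2, 3, 4, 5} {1, 2, 5} (by decide) (by decide)
  have s14 := sub {2, 4} {2, 5} {2, 4, 5} {2} (by decide) (by decide)
  have s15 := sub {1, 3} {1, 5} {1, 3, 5} {1} (by decide) (by decide)
  have s16 := sub {1, 3, 5} {2, 3, 5} {1, 2, 3, 5} {3, 5} (by decide) (by decide)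
  have s17 := sub {0, 1, 2, 3, 4} {1, 2, 3, 4, 5} {0, 1, 2, 3, 4, 5} {1, 2, 3, 4} (by decide) (by decide)
  have s18 := sub {0, 4} {3, 4} {0, 3, 4} {4} (by decide) (by decide)
  have s19 := sub {2, 3} {2, 4} {2, 3, 4} {2} (by decide) (by decide)
  have s20 := sub {0, 1, 2, 3} {0, 2, 3, 5} {0, 1, 2, 3, 5} {0, 2, 3} (by decide) (by decide)
  have s21 := sub {0, 1, 2, 3} {1, 2, 3, 4} {0, 1, 2, 3, 4} {1, 2, 3} (by decide) (by decide)
  have s22 := sub {0, 1, 4} {0, 2, 4} {0, 1, 2, 4} {0, 4} (by decide) (by decide)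
  have s23 := sub {0, 1, 2, 4} {0, 1, 2, 5} {0, 1, 2, 4, 5} {0, 1, 2} (by decide) (by decide)
  have s24 := sub {0, 1, 2, 3, 5} {0, 1, 2, 4, 5} {0, 1, 2, 3, 4, 5} {0, 1, 2, 5} (by decide) (by decide)
  have s25 := sub {0, 1} {1, 4} {0, 1, 4} {1} (by decide) (by decide)
  rw [old {0, 1, 2} (by decide), old {0} (by decide), old {1} (by decide), old {2} (by decide),
    old {0, 3} (by decide), old {1, 2, 3} (by decide), old {0, 1} (by decide),
    old {0, 2} (by decide), old {1, 2} (by decide), old {1, 3} (by decide), old {2, 3} (by decide)]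
  linarith

end FourVariables

section Scheme

lemma shannonEntropy_comp {Ω T α : Type} [MeasurableSpace Ω] [Fintype T] [Fintype α]
    (μ : Measure Ω) [IsFiniteMeasure μ] (Y : Ω → T) (hY : ∀ t, MeasurableSet (Y ⁻¹' {t}))
    (g : T → α) :
    shannonEntropy μ (fun ω => g (Y ω)) =
      partitionEntropy (fun t => (μ (Y ⁻¹' {t})).toReal) (Setoid.ker g) := by
  classical
  have hfib : ∀ a, (μ ((fun ω => g (Y ω)) ⁻¹' {a})).toReal =
      ∑ t with g t = a, (μ (Y ⁻¹' {t})).toReal := by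
    intro a
    have hset : (fun ω => g (Y ω)) ⁻¹' {a} = ⋃ t ∈ Finset.univ.filter (g · = a), Y ⁻¹' {t} := by
      ext ω
      simp
    rw [hset, measure_biUnion_finset, ENNReal.toReal_sum fun t _ => measure_ne_top μ _]
    · intro s _ t _ hst
      exact Disjoint.preimage _ (Set.disjoint_singleton.mpr hst)
    · exact fun t _ => hY t
  simp only [shannonEntropy, Real.negMulLog, partitionEntropy, hfib]
  rw [← Finset.sum_fiberwise Finset.univ g, ← Finset.sum_neg_distrib]
  refine Finset.sum_congr rfl fun a _ => ?_
  rw [neg_mul, Finset.sum_mul]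
  refine congrArg _ (Finset.sum_congr rfl fun t ht => ?_)
  rw [← (Finset.mem_filter.mp ht).2]
  congr 2

namespace Scheme

variable {P : Type} [Fintype P] [DecidableEq P]

/-- The shares and the secret of a scheme can be modelled by partitions of a finite weighted
space, with the secret at the index `none`. -/
lemma exists_partition_model (S : Scheme P) :
    ∃ (T : Type) (_ : Fintype T) (w : T → ℝ) (X : Option P → Setoid T), 0 ≤ w ∧
      (∀ I, S.Hset I = jointEntropy w X (I.map Function.Embedding.some)) ∧
      (∀ I, S.HsetS I = jointEntropy w X (Finset.insertNone I)) := by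
  let := S.mΩ
  let := S.secFin
  let := S.shFin
  have := S.prob
  let Y : S.Ω → (∀ p, S.ShT p) × S.SecT := fun ω => (fun p => S.share p ω, S.secret ω)
  let X : Option P → Setoid ((∀ p, S.ShT p) × S.SecT) := fun o =>
    o.elim (Setoid.ker Prod.snd) fun p => Setoid.ker fun t => t.1 p
  have hY : ∀ t, MeasurableSet (Y ⁻¹' {t}) := by
    intro t
    have : Y ⁻¹' {t} = (⋂ p, S.share p ⁻¹' {t.1 p}) ∩ S.secret ⁻¹' {t.2} := by
      ext ω
      simp [Y, Prod.ext_iff, funext_iff]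
    rw [this]
    exact (MeasurableSet.iInter fun p => S.share_meas p _).inter (S.secret_meas _)
  refine ⟨_, inferInstance, fun t => (S.μ (Y ⁻¹' {t})).toReal, X,
    fun t => ENNReal.toReal_nonneg, fun I => ?_, fun I => ?_⟩
  · refine (shannonEntropy_comp S.μ Y hY
      (fun t => fun p : {y // y ∈ I} => t.1 p.1)).trans (congrArg _ ?_)
    ext s t
    simp [finset_inf_rel, Setoid.ker_def, funext_iff, X]
    rfl
  · refine (shannonEntropy_comp S.μ Y hY
      (fun t => ((fun p : {y // y ∈ I} => t.1 p.1), t.2))).trans (congrArg _ ?_)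
    ext s t
    simp [finset_inf_rel, Setoid.ker_def, funext_iff, X, Option.forall, Prod.ext_iff, and_comm]
    rfl

lemma Hset_mono (S : Scheme P) {I J : Finset P} (h : I ⊆ J) : S.Hset I ≤ S.Hset J := by
  obtain ⟨T, _, w, X, hw, hH, -⟩ := S.exists_partition_model
  rw [hH, hH]
  exact jointEntropy_mono hw X (Finset.map_subset_map.mpr h)

lemma Hset_submodular (S : Scheme P) (I J : Finset P) :
    S.Hset (I ∪ J) + S.Hset (I ∩ J) ≤ S.Hset I + S.Hset J := by
  obtain ⟨T, _, w, X, hw, hH, -⟩ := S.exists_partition_model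
  rw [hH, hH, hH, hH, Finset.map_union, Finset.map_inter]
  exact jointEntropy_submodular hw X _ _

lemma HsetS_submodular (S : Scheme P) (I J : Finset P) :
    S.HsetS (I ∪ J) + S.HsetS (I ∩ J) ≤ S.HsetS I + S.HsetS J := by
  obtain ⟨T, _, w, X, hw, -, hH⟩ := S.exists_partition_model
  have hunion : Finset.insertNone (I ∪ J) = Finset.insertNone I ∪ Finset.insertNone J := by
    ext (_ | p) <;> simp
  have hinter : Finset.insertNone (I ∩ J) = Finset.insertNone I ∩ Finset.insertNone J := by
    ext (_ | p) <;> simp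
  rw [hH, hH, hH, hH, hunion, hinter]
  exact jointEntropy_submodular hw X _ _

lemma Hset_le_HsetS (S : Scheme P) (I : Finset P) : S.Hset I ≤ S.HsetS I := by
  obtain ⟨T, _, w, X, hw, hH, hH'⟩ := S.exists_partition_model
  rw [hH, hH']
  refine jointEntropy_mono hw X fun o ho => ?_
  obtain ⟨p, hp, rfl⟩ := Finset.mem_map.mp ho
  exact Finset.some_mem_insertNone.mpr hp

/-- Two qualified sets with unqualified intersection satisfy a strict form of submodularity. -/
lemma IsPerfect.Hset_strict_submodular {S : Scheme P} {Γ : Finset P → Prop} (h : S.IsPerfect Γ)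
    {I J : Finset P} (hI : Γ I) (hJ : Γ J) (hIJ : ¬ Γ (I ∩ J)) :
    S.Hset (I ∪ J) + S.Hset (I ∩ J) + S.Hsec ≤ S.Hset I + S.Hset J := by
  linarith [h.1 I hI, h.1 J hJ, h.2 _ hIJ, S.HsetS_submodular I J, S.Hset_le_HsetS (I ∪ J)]

/-- A non-Shannon inequality for the shares of four sets of participants. -/
lemma Hset_nonShannon (S : Scheme P) (A B C D : Finset P) :
    9 * S.Hset (A ∪ B ∪ C) + 3 * S.Hset A + 5 * S.Hset B + 3 * S.Hset C + 2 * S.Hset (A ∪ D) +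
        2 * S.Hset (B ∪ C ∪ D) ≤
      8 * S.Hset (A ∪ B) + 6 * S.Hset (A ∪ C) + 6 * S.Hset (B ∪ C) + 2 * S.Hset (B ∪ D) +
        2 * S.Hset (C ∪ D) := by
  obtain ⟨T, _, w, X, hw, hH, -⟩ := S.exists_partition_model
  let X' : Finset P → Setoid T := fun I => (I.map Function.Embedding.some).inf X
  have h := jointEntropy_fin_six_le hw ![X' A, X' B, X' C, X' D, ⊤, ⊤]
  simpa [hH, jointEntropy, X', Finset.map_union, Finset.inf_union, inf_assoc] using h

end Scheme

end Scheme

section Vamos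

lemma vamosQualified_of_circuit {x : Fin 8} {M Y : Finset (Fin 8)} (hM : M ⊆ Y) (hx : x ∉ M)
    (hcard : (insert x M).card = 5)
    (hspecial : ¬ pairA ∪ pairB ⊆ insert x M ∧ ¬ pairA ∪ pairC ⊆ insert x M ∧
      ¬ pairB ∪ pairC ⊆ insert x M ∧ ¬ pairB ∪ pairD ⊆ insert x M ∧
      ¬ pairC ∪ pairD ⊆ insert x M) :
    VamosQualified x Y := by
  refine Or.inr ⟨M, hM, hx, by simp [VamosDep, hcard], fun Z hZ => ?_⟩
  obtain ⟨h₁, h₂, h₃, h₄, h₅⟩ := hspecial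
  have hlt := Finset.card_lt_card hZ
  rintro (rfl | rfl | rfl | rfl | rfl | h)
  exacts [h₁ hZ.1, h₂ hZ.1, h₃ hZ.1, h₄ hZ.1, h₅ hZ.1, by omega]

instance : DecidablePred VamosDep := fun X => by unfold VamosDep; infer_instance

/-- A set without the dealer is unqualified as soon as each of its subsets is either independent
together with the dealer or dependent by itself. -/
lemma not_vamosQualified {x : Fin 8} {Y : Finset (Fin 8)} (hx : x ∉ Y)
    (h : ∀ M ∈ Y.powerset, ¬ VamosDep (insert x M) ∨ VamosDep M) :
    ¬ VamosQualified x Y := by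
  rintro (h' | ⟨M, hM, hxM, hdep, hmin⟩)
  · exact hx h'
  · exact (h M (Finset.mem_powerset.mpr hM)).elim (· hdep)
      (hmin M (Finset.ssubset_insert hxM))

end Vamos

set_option maxRecDepth 100000 in
/-- If the dealer is a member of the Vamos pair `C`, then
`16 ≤ 6·h(C|A) + 5·h(C|B) + h(B|C) + 2·h(D|C)`. -/
theorem dealer_in_C_ineq (x : Fin 8) (hx : x ∈ pairC)
    (S : Scheme (Fin 8)) (hperf : S.IsPerfect (VamosQualified x)) (hpos : 0 < S.Hsec) :
    16 ≤ 6 * S.hcond pairC pairA + 5 * S.hcond pairC pairB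
        + S.hcond pairB pairC + 2 * S.hcond pairD pairC := by
  have mem : ∀ Y : Finset (Fin 8), pairC ⊆ Y → VamosQualified x Y := fun Y h => Or.inl (h hx)
  have hx' : x = 4 ∨ x = 5 := by simpa [pairC] using hx
  have qAD : ∀ Y : Finset (Fin 8), pairA ∪ pairD ⊆ Y → VamosQualified x Y := fun Y hY => by
    refine vamosQualified_of_circuit hY ?_ ?_ ?_ <;> rcases hx' with rfl | rfl <;> decide
  have qABd : VamosQualified x {0, 1, 2, 3, 6} := by
    refine vamosQualified_of_circuit (M := {0, 2, 3, 6}) ?_ ?_ ?_ ?_ <;>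
      rcases hx' with rfl | rfl <;> decide
  have qABe : VamosQualified x {0, 1, 2, 3, 7} := by
    refine vamosQualified_of_circuit (M := {0, 2, 3, 7}) ?_ ?_ ?_ ?_ <;>
      rcases hx' with rfl | rfl <;> decide
  have nAB : ¬ VamosQualified x {0, 1, 2, 3} := by
    refine not_vamosQualified ?_ ?_ <;> rcases hx' with rfl | rfl <;> decide
  have nBD : ¬ VamosQualified x {2, 3, 6, 7} := by
    refine not_vamosQualified ?_ ?_ <;> rcases hx' with rfl | rfl <;> decide
  have nAd : ¬ VamosQualified x {0, 1, 6} := by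
    refine not_vamosQualified ?_ ?_ <;> rcases hx' with rfl | rfl <;> decide
  have nAe : ¬ VamosQualified x {0, 1, 7} := by
    refine not_vamosQualified ?_ ?_ <;> rcases hx' with rfl | rfl <;> decide
  have strict : ∀ I J U K : Finset (Fin 8), I ∪ J = U → I ∩ J = K → VamosQualified x I →
      VamosQualified x J → ¬ VamosQualified x K →
      S.Hset U + S.Hset K + S.Hsec ≤ S.Hset I + S.Hset J := by
    rintro I J _ _ rfl rfl hI hJ hIJ
    exact hperf.Hset_strict_submodular hI hJ hIJ
  have sub : ∀ I J U K : Finset (Fin 8), I ∪ J = U → I ∩ J = K →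
      S.Hset U + S.Hset K ≤ S.Hset I + S.Hset J := by
    rintro I J _ _ rfl rfl
    exact S.Hset_submodular I J
  have s1 := strict {0, 1, 2, 3, 4, 5} {0, 1, 2, 3, 6} {0, 1, 2, 3, 4, 5, 6}
    {0, 1, 2, 3} (by decide) (by decide)
    (mem _ (by decide)) qABd nAB
  have s2 := strict {0, 1, 2, 3, 7} {0, 1, 4, 5, 7} {0, 1, 2, 3, 4, 5, 7}
    {0, 1, 7} (by decide) (by decide)
    qABe (mem _ (by decide)) nAe
  have s3 := strict {0, 1, 4, 5, 7} {0, 1, 6, 7} {0, 1, 4, 5, 6, 7}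
    {0, 1, 7} (by decide) (by decide)
    (mem _ (by decide)) (qAD _ (by decide)) nAe
  have s4 := strict {0, 1, 2, 3, 6, 7} {2, 3, 4, 5, 6, 7} {0, 1, 2, 3, 4, 5, 6, 7}
    {2, 3, 6, 7} (by decide) (by decide)
    (qAD _ (by decide)) (mem _ (by decide)) nBD
  have s5 := strict {0, 1, 4, 5, 6} {0, 1, 6, 7} {0, 1, 4, 5, 6, 7}
    {0, 1, 6} (by decide) (by decide)
    (mem _ (by decide)) (qAD _ (by decide)) nAd
  have t1 := sub {0, 1, 2, 3} {0, 1, 7} {0, 1, 2, 3, 7}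
    {0, 1} (by decide) (by decide)
  have t2 := sub {0, 1, 6} {0, 1, 7} {0, 1, 6, 7}
    {0, 1} (by decide) (by decide)
  have t3 := sub {0, 1, 2, 3, 4, 5, 6} {0, 1, 4, 5, 6, 7} {0, 1, 2, 3, 4, 5, 6, 7}
    {0, 1, 4, 5, 6} (by decide) (by decide)
  have t4 := sub {0, 1, 2, 3, 4, 5, 7} {0, 1, 4, 5, 6, 7} {0, 1, 2, 3, 4, 5, 6, 7}
    {0, 1, 4, 5, 7} (by decide) (by decide)
  have t5 := sub {0, 1, 2, 3, 4, 5, 6} {0, 1, 2, 3, 6, 7} {0, 1, 2, 3, 4, 5, 6, 7}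
    {0, 1, 2, 3, 6} (by decide) (by decide)
  have m1 := S.Hset_mono (I := {0, 1, 2, 3, 6, 7}) (J := {0, 1, 2, 3, 4, 5, 6, 7}) (by decide)
  have m2 := S.Hset_mono (I := {0, 1, 4, 5, 6, 7}) (J := {0, 1, 2, 3, 4, 5, 6, 7}) (by decide)
  have m3 := S.Hset_mono (I := {0, 1, 2, 3, 4, 5, 7}) (J := {0, 1, 2, 3, 4, 5, 6, 7}) (by decide)
  have m4 := S.Hset_mono (I := {0, 1, 2, 3, 4, 5, 6}) (J := {0, 1, 2, 3, 4, 5, 6, 7}) (by decide)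
  have h := S.Hset_nonShannon pairA pairB pairC pairD
  rw [show pairA ∪ pairB ∪ pairC = {0, 1, 2, 3, 4, 5} by decide,
    show pairA ∪ pairD = {0, 1, 6, 7} by decide,
    show pairB ∪ pairC ∪ pairD = {2, 3, 4, 5, 6, 7} by decide,
    show pairA ∪ pairB = {0, 1, 2, 3} by decide, show pairA ∪ pairC = {0, 1, 4, 5} by decide,
    show pairB ∪ pairC = {2, 3, 4, 5} by decide, show pairB ∪ pairD = {2, 3, 6, 7} by decide,
    show pairC ∪ pairD = {4, 5, 6, 7} by decide, pairA] at h
  have key : 16 * S.Hsec ≤ 6 * (S.Hset (pairC ∪ pairA) - S.Hset pairA) +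
      5 * (S.Hset (pairC ∪ pairB) - S.Hset pairB) + (S.Hset (pairB ∪ pairC) - S.Hset pairC) +
      2 * (S.Hset (pairD ∪ pairC) - S.Hset pairC) := by
    rw [show pairC ∪ pairA = {0, 1, 4, 5} by decide, show pairC ∪ pairB = {2, 3, 4, 5} by decide,
      show pairB ∪ pairC = {2, 3, 4, 5} by decide, show pairD ∪ pairC = {4, 5, 6, 7} by decide, pairA]
    linarith
  calc (16 : ℝ) ≤ _ := (le_div_iff₀ hpos).mpr key
    _ = _ := by
      simp only [Scheme.hcond, Scheme.hset]
      ring
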